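/- (Claim (i) in the proof of Theorem 1: one round of Binary Power Packing responses yields a repulsive allocation.) Let N = 2 and M ≥ 1. Let p_1 ∈ {0,P_max}^M be any binary allocation for link 1, and let p_2 ∈ {0,P_max}^M be any BPP response of link 2 (for any tie-breaking rule consistent with ordering slots by nondecreasing interference) to the interference levels I_m = N_0 + g_{12} p_{1m} generated by p_1. Then the pair (p_1, p_2) is a repulsive allocation. -/

import Mathlib

open Finset

/-- A two-link `M`-slot allocation `p` is repulsive if, after a permutation `σ`
of the slots (slots indexed `1,…,M` via `m.val + 1`), link 1 transmits at full
power in a prefix (up to slot `m₁`, with slot `m₁+1` arbitrary and zero after)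
and link 2 transmits at full power in a suffix (from slot `m₂`, with slot
`m₂−1` arbitrary and zero before). -/
def Repulsive {M : ℕ} (Pmax : ℝ) (p : Fin 2 → Fin M → ℝ) : Prop :=
  ∃ σ : Equiv.Perm (Fin M), ∃ m₁ m₂ : ℕ, m₁ ≤ M + 1 ∧ m₂ ≤ M + 1 ∧
    ∀ m : Fin M,
      (m.val + 1 ≤ m₁ → p 0 (σ m) = Pmax) ∧
      (m₁ + 1 < m.val + 1 → p 0 (σ m) = 0) ∧
      (m₂ ≤ m.val + 1 → p 1 (σ m) = Pmax) ∧
      (m.val + 1 < m₂ - 1 → p 1 (σ m) = 0)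

/-- `q` is a Binary Power Packing response to interference levels `I` for a
transmitter with direct gain `gii`, power budget `Pmax` and target rate `Rt`:
if even full power in every slot does not reach the target, `q = 0`; otherwise,
order the slots by nondecreasing interference via some permutation `σ` (any
tie-breaking), and transmit at full power exactly in the first `m̃` slots,
where `m̃` is the least number of slots whose full-power rates reach the
target. -/
def IsBPPResponse {M : ℕ} (f : ℝ → ℝ) (gii Pmax Rt : ℝ)
    (I : Fin M → ℝ) (q : Fin M → ℝ) : Prop :=
  ((1 / (M : ℝ)) * ∑ m, f (gii * Pmax / I m) < Rt → q = 0) ∧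
  (Rt ≤ (1 / (M : ℝ)) * ∑ m, f (gii * Pmax / I m) →
    ∃ σ : Equiv.Perm (Fin M),
      (∀ l l' : Fin M, l ≤ l' → I (σ l) ≤ I (σ l')) ∧
      ∃ mt : ℕ,
        IsLeast {k : ℕ | Rt ≤ (1 / (M : ℝ)) *
          ∑ m ∈ univ.filter (fun m : Fin M => m.val < k),
            f (gii * Pmax / I (σ m))} mt ∧
        ∀ m : Fin M, q (σ m) = if m.val < mt then Pmax else 0)

/-- A monotone sequence with values in `{0, c}`, `c > 0`, is a block of zeros followed by a block
of `c`s. -/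
lemma exists_threshold_of_monotone_of_binary {M : ℕ} {c : ℝ} (hc : 0 < c) {u : Fin M → ℝ}
    (hu : Monotone u) (hbin : ∀ m, u m = 0 ∨ u m = c) :
    ∃ k ≤ M, ∀ m : Fin M, u m = if m.val < k then 0 else c := by
  classical
  have hex : ∃ k, ∀ m : Fin M, k ≤ m.val → u m = c := ⟨M, fun m hm => by omega⟩
  refine ⟨Nat.find hex, Nat.find_min' hex fun m hm => by omega, fun m => ?_⟩
  split_ifs with h
  · by_contra hne
    refine Nat.find_min hex h fun m' hm' => ?_
    have hle : u m ≤ u m' := hu (Fin.le_def.mpr hm')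
    rw [(hbin m).resolve_left hne] at hle
    exact (hbin m').resolve_left (hc.trans_le hle).ne'
  · exact Nat.find_spec hex m (not_lt.mp h)

/-- If some ordering of the slots makes the binary allocation of link 1 nondecreasing and lets
link 2 transmit exactly in an initial block, then the pair is repulsive. -/
lemma repulsive_of_monotone_of_prefix {M : ℕ} {Pmax : ℝ} (hP : 0 < Pmax) {p : Fin 2 → Fin M → ℝ}
    (hbin : ∀ m, p 0 m = 0 ∨ p 0 m = Pmax) (σ : Equiv.Perm (Fin M))
    (hmono : Monotone (p 0 ∘ σ)) (n : ℕ)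
    (hpre : ∀ m : Fin M, p 1 (σ m) = if m.val < n then Pmax else 0) :
    Repulsive Pmax p := by
  obtain ⟨k, hk, hu⟩ := exists_threshold_of_monotone_of_binary hP hmono fun m => hbin (σ m)
  refine ⟨Fin.revPerm.trans σ, M - k, M - n + 1, by omega, by omega, fun m => ?_⟩
  have h0 := hu m.rev
  have h1 := hpre m.rev
  rw [Fin.val_rev] at h0 h1
  simp only [Function.comp_apply] at h0
  simp only [Equiv.trans_apply, Fin.revPerm_apply, h0, h1]
  have hm := m.isLt
  refine ⟨fun h => if_neg ?_, fun h => if_pos ?_, fun h => if_pos ?_, fun h => if_neg ?_⟩ <;> omega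

/-- Claim (i) in the proof of Theorem 1: for two links, if link 1 uses any
binary allocation `p 0` and link 2 responds with any Binary Power Packing
response `p 1` to the interference generated by `p 0`, the resulting pair is a
repulsive allocation. -/
theorem bpp_response_yields_repulsive_allocation
    (M : ℕ) (hM : 1 ≤ M) (f : ℝ → ℝ) (g : Fin 2 → Fin 2 → ℝ) (N0 Pmax : ℝ)
    (hg : ∀ i j, 0 < g i j) (hN0 : 0 < N0) (hP : 0 < Pmax)
    (hf_cont : ContinuousOn f (Set.Ici 0)) (hf_mono : MonotoneOn f (Set.Ici 0))
    (hf_conc : ConcaveOn ℝ (Set.Ici 0) f) (hf0 : f 0 = 0)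
    (hf_nonneg : ∀ x ∈ Set.Ici (0 : ℝ), 0 ≤ f x)
    (Rt2 : ℝ)
    (p : Fin 2 → Fin M → ℝ)
    (hbin1 : ∀ m, p 0 m ∈ ({0, Pmax} : Set ℝ))
    (hresp : IsBPPResponse f (g 1 1) Pmax Rt2
      (fun m => N0 + g 0 1 * p 0 m) (p 1)) :
    Repulsive Pmax p := by
  have hbin : ∀ m, p 0 m = 0 ∨ p 0 m = Pmax := fun m => by simpa using hbin1 m
  obtain ⟨hlow, hhigh⟩ := hresp
  rcases lt_or_ge ((1 / (M : ℝ)) * ∑ m, f (g 1 1 * Pmax / (N0 + g 0 1 * p 0 m))) Rt2 with h | h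
  · exact repulsive_of_monotone_of_prefix hP hbin (Tuple.sort (p 0)) (Tuple.monotone_sort (p 0)) 0
      fun m => by simp [hlow h]
  · obtain ⟨σ, hσ, n, -, hn⟩ := hhigh h
    exact repulsive_of_monotone_of_prefix hP hbin σ
      (fun l l' hl => le_of_mul_le_mul_left (le_of_add_le_add_left (hσ l l' hl)) (hg 0 1)) n hn
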